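/- Let B be an m×n dual quaternion matrix and A = B* B. Then A is a perfect Hermitian matrix: there exists a positive semidefinite dual quaternion Hermitian matrix L ∈ 𝔻ℚ^{n×n} such that L² = A. -/

import Mathlib

open TrivSqZeroExt Matrix

/-- The quaternions. -/
abbrev HQ := Quaternion ℝ

/-- The dual quaternions: `q = q_st + q_I ε` with `ε² = 0`, `ε` commuting with quaternions. -/
abbrev DQ := DualNumber HQ

/-- Conjugation of a dual quaternion: `q* = q_st* + q_I* ε`. -/
noncomputable instance : Star DQ :=
  ⟨fun q => inl (star (fst q)) + inr (star (snd q))⟩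

/-- A dual quaternion is appreciable if its standard part is nonzero. -/
def DQ.Appreciable (q : DQ) : Prop := fst q ≠ 0

/-- A dual quaternion is a dual number if both parts are real. -/
def DQ.IsDualNum (q : DQ) : Prop := ∃ a b : ℝ, q = inl (a : HQ) + inr (b : HQ)

/-- The total order on dual numbers: `p ≤ q` iff `p_st < q_st`, or `p_st = q_st` and `p_I ≤ q_I`. -/
def DQ.le (p q : DQ) : Prop :=
  (fst p).re < (fst q).re ∨ ((fst p).re = (fst q).re ∧ (snd p).re ≤ (snd q).re)

/-- The strict total order on dual numbers. -/
def DQ.lt (p q : DQ) : Prop :=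
  (fst p).re < (fst q).re ∨ ((fst p).re = (fst q).re ∧ (snd p).re < (snd q).re)

/-- The algebra map sending a square quaternionic matrix to its left action on column vectors,
regarded as a real-linear operator on a Euclidean space. -/
noncomputable def quaternionMatrixAction (n : Type*) [Fintype n] [DecidableEq n] :
    Matrix n n HQ →ₐ[ℝ] Module.End ℝ (PiLp 2 fun _ : n => HQ) :=
  AlgHom.ofLinearMap
    { toFun M :=
        { toFun x := WithLp.toLp 2 (M *ᵥ WithLp.ofLp x)
          map_add' x y := by simp [mulVec_add]
          map_smul' r x := by simp [mulVec_smul] }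
      map_add' M N := LinearMap.ext fun x => congrArg (WithLp.toLp 2) (add_mulVec M N _)
      map_smul' r M := LinearMap.ext fun x => congrArg (WithLp.toLp 2) (smul_mulVec r M _) }
    (LinearMap.ext fun x => congrArg (WithLp.toLp 2) (one_mulVec (WithLp.ofLp x)))
    (fun M N => LinearMap.ext fun x =>
      congrArg (WithLp.toLp 2) (mulVec_mulVec (WithLp.ofLp x) M N).symm)

lemma quaternionMatrixAction_apply {n : Type*} [Fintype n] [DecidableEq n] (M : Matrix n n HQ)
    (x : PiLp 2 fun _ : n => HQ) :
    quaternionMatrixAction n M x = WithLp.toLp 2 (M *ᵥ WithLp.ofLp x) := rfl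

lemma quaternionMatrixAction_injective (n : Type*) [Fintype n] [DecidableEq n] :
    Function.Injective (quaternionMatrixAction n) := by
  intro M N h
  ext1 i j
  have h' := congrArg (fun T : Module.End ℝ (PiLp 2 fun _ : n => HQ) =>
    WithLp.ofLp (T (WithLp.toLp 2 (Pi.single j 1))) i) h
  simpa [quaternionMatrixAction_apply] using h'

lemma Quaternion.re_mul_comm (a b : HQ) : (a * b).re = (b * a).re := by
  simp only [Quaternion.re_mul]; ring

lemma Quaternion.re_finset_sum {ι : Type*} (s : Finset ι) (f : ι → HQ) :
    (∑ i ∈ s, f i).re = ∑ i ∈ s, (f i).re :=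
  map_sum (AddMonoidHom.mk' (fun q : HQ => q.re) fun _ _ => rfl) f s

lemma inner_eq_re_dotProduct {n : Type*} [Fintype n] (x y : PiLp 2 fun _ : n => HQ) :
    inner ℝ x y = (star (WithLp.ofLp x) ⬝ᵥ WithLp.ofLp y).re := by
  simp only [PiLp.inner_apply, dotProduct, Quaternion.re_finset_sum, Quaternion.inner_def, Pi.star_apply]
  refine Finset.sum_congr rfl fun i _ => ?_
  rw [← Quaternion.re_star]
  simp only [star_mul, star_star, Quaternion.re_mul_comm (star (WithLp.ofLp x i))]

lemma re_star_dotProduct_self_nonneg {n : Type*} [Fintype n] (x : n → HQ) :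
    0 ≤ (star x ⬝ᵥ x).re := by
  rw [← inner_eq_re_dotProduct (WithLp.toLp 2 x) (WithLp.toLp 2 x)]
  exact real_inner_self_nonneg

lemma re_star_dotProduct_self_eq_zero {n : Type*} [Fintype n] {x : n → HQ} :
    (star x ⬝ᵥ x).re = 0 ↔ x = 0 := by
  rw [← inner_eq_re_dotProduct (WithLp.toLp 2 x) (WithLp.toLp 2 x), inner_self_eq_zero]
  simp

lemma star_mulVec_dotProduct {m n : Type*} [Fintype m] [Fintype n] (M : Matrix m n HQ)
    (x : n → HQ) (y : m → HQ) : star (M *ᵥ x) ⬝ᵥ y = star x ⬝ᵥ (Mᴴ *ᵥ y) := by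
  rw [star_mulVec, dotProduct_mulVec]

lemma quaternion_eq_zero_of_conjTranspose_mul_self {m n : Type*} [Fintype m] [Fintype n]
    {M : Matrix m n HQ} (h : Mᴴ * M = 0) : M = 0 := by
  classical
  have hx (x : n → HQ) : M *ᵥ x = 0 := by
    rw [← re_star_dotProduct_self_eq_zero, star_mulVec_dotProduct, mulVec_mulVec, h,
      zero_mulVec, dotProduct_zero, Quaternion.re_zero]
  ext1 i j
  simpa using congrFun (hx (Pi.single j 1)) i

lemma star_aeval {A : Type*} [Ring A] [StarRing A] [Algebra ℝ A] [StarModule ℝ A] (a : A)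
    (p : Polynomial ℝ) : star (Polynomial.aeval a p) = Polynomial.aeval (star a) p := by
  induction p using Polynomial.induction_on' with
  | add p q hp hq => simp [hp, hq]
  | monomial k r =>
    simp only [Polynomial.aeval_monomial, star_pow, Algebra.algebraMap_eq_smul_one,
      star_smul, star_trivial, smul_mul_assoc, one_mul]

open Polynomial in
/-- A Gram matrix over the quaternions is annihilated by a real polynomial with distinct
nonnegative roots, one of which is zero. -/
lemma exists_aeval_prod_gram_eq_zero {m n : Type*} [Fintype m] [Fintype n] [DecidableEq n]
    (B : Matrix m n HQ) :
    ∃ s : Finset ℝ, 0 ∈ s ∧ (∀ a ∈ s, 0 ≤ a) ∧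
      aeval (Bᴴ * B) (∏ a ∈ s, (X - C a)) = 0 := by
  set T := quaternionMatrixAction n (Bᴴ * B) with hT
  have hpos : T.IsPositive := by
    rw [LinearMap.IsPositive]
    refine ⟨fun x y => ?_, fun x => ?_⟩
    · simp only [inner_eq_re_dotProduct, hT, quaternionMatrixAction_apply,
        star_mulVec_dotProduct, conjTranspose_mul, conjTranspose_conjTranspose]
    · simp only [inner_eq_re_dotProduct, hT, quaternionMatrixAction_apply,
        star_mulVec_dotProduct, conjTranspose_mul, conjTranspose_conjTranspose, RCLike.re_to_real]
      rw [← mulVec_mulVec, ← star_mulVec_dotProduct]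
      exact re_star_dotProduct_self_nonneg _
  refine ⟨insert 0 (Finset.univ.image (hpos.isSymmetric.eigenvalues rfl)), by simp, ?_, ?_⟩
  · simp only [Finset.mem_insert, Finset.mem_image, Finset.mem_univ, true_and]
    rintro a (rfl | ⟨i, rfl⟩)
    · rfl
    · exact hpos.nonneg_eigenvalues rfl i
  · apply quaternionMatrixAction_injective n
    rw [map_zero, ← aeval_algHom_apply, ← hT]
    refine (hpos.isSymmetric.eigenvectorBasis rfl).toBasis.ext fun i => ?_
    rw [OrthonormalBasis.coe_toBasis, Module.End.aeval_apply_of_hasEigenvector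
      (hpos.isSymmetric.hasEigenvector_eigenvectorBasis rfl i), eval_prod,
      Finset.prod_eq_zero (i := hpos.isSymmetric.eigenvalues rfl i)]
    · simp
    · simp
    · simp

open Polynomial in
/-- Spectral resolution attached to an annihilating polynomial with distinct roots. -/
lemma exists_spectral_resolution {A : Type*} [Ring A] [StarRing A] [Algebra ℝ A]
    [StarModule ℝ A] {a : A} (ha : star a = a) {s : Finset ℝ} (hs : s.Nonempty)
    (h : aeval a (∏ r ∈ s, (X - C r)) = 0) :
    ∃ P : ℝ → A, (∀ r, star (P r) = P r) ∧
      (∀ r ∈ s, ∀ t ∈ s, P r * P t = if r = t then P r else 0) ∧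
      ∑ r ∈ s, P r = 1 ∧ ∑ r ∈ s, r • P r = a := by
  let P : ℝ → A := fun r => aeval a (Lagrange.basis s id r)
  have hsum : ∑ r ∈ s, P r = 1 := by
    rw [← map_sum, Lagrange.sum_basis Function.injective_id.injOn hs, map_one]
  have hcomm (r) : P r * a = a * P r := by
    have := congrArg (aeval a) (mul_comm (Lagrange.basis s id r) X)
    simpa using this
  have hmul (r) (hr : r ∈ s) : a * P r = r • P r := by
    have h0 : (X - C r) * Lagrange.basis s id r =
        (∏ t ∈ s.erase r, C (r - t)⁻¹) * ∏ t ∈ s, (X - C t) := by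
      simp only [Lagrange.basis, Lagrange.basisDivisor, Finset.prod_mul_distrib, id]
      rw [← Finset.mul_prod_erase s _ hr]
      ring
    have h1 := congrArg (aeval a) h0
    rw [map_mul, map_mul, h, mul_zero, map_sub, aeval_X, aeval_C, sub_mul, sub_eq_zero] at h1
    rw [h1, Algebra.smul_def]
  have horth (r) (hr : r ∈ s) (t) (ht : t ∈ s) (hrt : r ≠ t) : P r * P t = 0 := by
    have h1 : r • (P r * P t) = t • (P r * P t) := by
      rw [← smul_mul_assoc, ← hmul r hr, ← hcomm, mul_assoc, hmul t ht, mul_smul_comm]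
    rw [← sub_eq_zero, ← sub_smul] at h1
    exact (smul_eq_zero.mp h1).resolve_left (sub_ne_zero.mpr hrt)
  refine ⟨P, fun r => ?_, fun r hr t ht => ?_, hsum, ?_⟩
  · simp only [P, star_aeval, ha]
  · split_ifs with hrt
    · subst hrt
      calc P r * P r = P r * ∑ t ∈ s, P t := by
            rw [Finset.mul_sum, Finset.sum_eq_single_of_mem r hr
              fun t ht htr => horth r hr t ht htr.symm]
        _ = P r := by rw [hsum, mul_one]
    · exact horth r hr t ht hrt
  · rw [← Finset.sum_congr rfl hmul, ← Finset.mul_sum, hsum, mul_one]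

lemma sum_smul_mul_sum_smul {A : Type*} [Ring A] [Algebra ℝ A] {s : Finset ℝ} {P : ℝ → A}
    (hP : ∀ r ∈ s, ∀ t ∈ s, P r * P t = if r = t then P r else 0) (f g : ℝ → ℝ) :
    (∑ r ∈ s, f r • P r) * ∑ r ∈ s, g r • P r = ∑ r ∈ s, (f r * g r) • P r := by
  simp only [Finset.sum_mul_sum, smul_mul_smul_comm]
  refine Finset.sum_congr rfl fun r hr => ?_
  rw [Finset.sum_eq_single_of_mem r hr fun t ht htr => by rw [hP r hr t ht, if_neg htr.symm,
    smul_zero], hP r hr r hr, if_pos rfl]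

/-- The square root of a quaternionic Gram matrix `B₀ᴴ * B₀`, together with a solution of the
Lyapunov equation governing its first-order perturbation. -/
lemma exists_sqrt_gram_and_lyapunov {m n : Type*} [Fintype m] [Fintype n]
    (B₀ B₁ : Matrix m n HQ) :
    ∃ L₀ L₁ : Matrix n n HQ, L₀ᴴ = L₀ ∧ L₁ᴴ = L₁ ∧
      (∀ x, 0 ≤ (star x ⬝ᵥ L₀ *ᵥ x).re) ∧
      (∀ x, (star x ⬝ᵥ L₀ *ᵥ x).re = 0 → L₀ *ᵥ x = 0 ∧ star x ⬝ᵥ L₁ *ᵥ x = 0) ∧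
      L₀ * L₀ = B₀ᴴ * B₀ ∧ L₀ * L₁ + L₁ * L₀ = B₀ᴴ * B₁ + B₁ᴴ * B₀ := by
  classical
  have : StarModule ℝ HQ := ⟨Quaternion.star_smul⟩
  obtain ⟨s, h0s, hnn, hs⟩ := exists_aeval_prod_gram_eq_zero B₀
  obtain ⟨P, hstar, hP, hsum, hspec⟩ := exists_spectral_resolution
    (by simp [star_eq_conjTranspose]) ⟨0, h0s⟩ hs
  replace hstar (r) : (P r)ᴴ = P r := hstar r
  set C := B₀ᴴ * B₁ + B₁ᴴ * B₀ with hC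
  have hCstar : Cᴴ = C := by simp [hC, add_comm]
  have hBP : B₀ * P 0 = 0 := by
    apply quaternion_eq_zero_of_conjTranspose_mul_self
    rw [conjTranspose_mul, hstar, Matrix.mul_assoc, ← Matrix.mul_assoc B₀ᴴ, ← hspec,
      Finset.sum_mul, Finset.sum_eq_zero, Matrix.mul_zero]
    intro r hr
    rw [smul_mul_assoc, hP r hr 0 h0s]
    split_ifs with h <;> simp [h]
  have hPCP : P 0 * C * P 0 = 0 := by
    have hPB : P 0 * B₀ᴴ = 0 := by
      rw [← hstar, ← conjTranspose_mul, hBP, conjTranspose_zero]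
    rw [hC, Matrix.mul_add, Matrix.add_mul, ← Matrix.mul_assoc, hPB, Matrix.zero_mul,
      Matrix.zero_mul, Matrix.mul_assoc, Matrix.mul_assoc, hBP, Matrix.mul_zero, Matrix.mul_zero,
      add_zero]
  let L₀ := ∑ r ∈ s, √r • P r
  let L₁ := ∑ r ∈ s, ∑ t ∈ s, (√r + √t)⁻¹ • (P r * C * P t)
  let K := ∑ r ∈ s, √√r • P r
  have hKK : Kᴴ * K = L₀ := by
    have hK : Kᴴ = K := by simp [K, conjTranspose_sum, hstar]
    rw [hK, sum_smul_mul_sum_smul hP]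
    exact Finset.sum_congr rfl fun r _ => by rw [Real.mul_self_sqrt (Real.sqrt_nonneg r)]
  have hPL (r) (hr : r ∈ s) : P r * L₀ = √r • P r := by
    simp only [L₀, Finset.mul_sum, mul_smul_comm]
    rw [Finset.sum_eq_single_of_mem r hr fun t ht htr => by rw [hP r hr t ht, if_neg htr.symm,
      smul_zero], hP r hr r hr, if_pos rfl]
  have hLP (r) (hr : r ∈ s) : L₀ * P r = √r • P r := by
    simp only [L₀, Finset.sum_mul, smul_mul_assoc]
    rw [Finset.sum_eq_single_of_mem r hr fun t ht htr => by rw [hP t ht r hr, if_neg htr,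
      smul_zero], hP r hr r hr, if_pos rfl]
  have hquad (x : n → HQ) : star x ⬝ᵥ L₀ *ᵥ x = star (K *ᵥ x) ⬝ᵥ (K *ᵥ x) := by
    rw [star_mulVec_dotProduct, mulVec_mulVec, hKK]
  refine ⟨L₀, L₁, ?_, ?_, fun x => ?_, fun x hx => ?_, ?_, ?_⟩
  · simp [L₀, conjTranspose_sum, hstar]
  · simp only [L₁, conjTranspose_sum, conjTranspose_smul, conjTranspose_mul, hstar, hCstar,
      star_trivial]
    rw [Finset.sum_comm]
    simp only [add_comm, Matrix.mul_assoc]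
  · rw [hquad]
    exact re_star_dotProduct_self_nonneg _
  · rw [hquad, re_star_dotProduct_self_eq_zero] at hx
    have hL : L₀ *ᵥ x = 0 := by rw [← hKK, ← mulVec_mulVec, hx, mulVec_zero]
    refine ⟨hL, ?_⟩
    have hPx (r) (hr : r ∈ s) (hr0 : r ≠ 0) : P r *ᵥ x = 0 := by
      have h1 : √r • (P r *ᵥ x) = 0 := by
        rw [← smul_mulVec, ← hPL r hr, ← mulVec_mulVec, hL, mulVec_zero]
      exact (smul_eq_zero.mp h1).resolve_left
        (Real.sqrt_ne_zero'.mpr ((hnn r hr).lt_of_ne hr0.symm))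
    have hx0 : P 0 *ᵥ x = x := by
      conv_rhs => rw [← one_mulVec x, ← hsum, sum_mulVec]
      rw [Finset.sum_eq_single_of_mem 0 h0s fun r hr hr0 => hPx r hr hr0]
    have hxL : L₁ *ᵥ x = ∑ r ∈ s, (√r)⁻¹ • (P r *ᵥ (C *ᵥ x)) := by
      simp only [L₁, sum_mulVec, smul_mulVec]
      refine Finset.sum_congr rfl fun r hr => ?_
      rw [Finset.sum_eq_single_of_mem 0 h0s fun t ht ht0 => by
        rw [← mulVec_mulVec, hPx t ht ht0, mulVec_zero, smul_zero]]
      simp [← mulVec_mulVec, hx0]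
    rw [← hx0, star_mulVec_dotProduct, hstar, hx0, hxL, mulVec_sum, Finset.sum_eq_zero,
      dotProduct_zero]
    intro r hr
    rw [mulVec_smul, mulVec_mulVec, hP 0 h0s r hr]
    split_ifs with h
    · subst h
      simp
    · simp
  · rw [sum_smul_mul_sum_smul hP, ← hspec]
    exact Finset.sum_congr rfl fun r hr => by rw [Real.mul_self_sqrt (hnn r hr)]
  · have hCC : C = ∑ r ∈ s, ∑ t ∈ s, P r * C * P t := by
      conv_lhs => rw [← Matrix.one_mul C, ← Matrix.mul_one (1 * C), ← hsum]
      simp only [Finset.sum_mul, Finset.mul_sum]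
      exact Finset.sum_comm
    conv_rhs => rw [hCC]
    simp only [L₁, Finset.mul_sum, Finset.sum_mul, ← Finset.sum_add_distrib]
    refine Finset.sum_congr rfl fun r hr => Finset.sum_congr rfl fun t ht => ?_
    rw [mul_smul_comm, smul_mul_assoc, Matrix.mul_assoc _ (P t), hPL t ht, Matrix.mul_assoc (P r),
      ← Matrix.mul_assoc L₀, hLP r hr, smul_mul_assoc, mul_smul_comm, ← Matrix.mul_assoc,
      ← smul_add, ← add_smul, smul_smul]
    by_cases h : √r + √t = 0
    · have hr0 := (add_eq_zero_iff_of_nonneg (Real.sqrt_nonneg r) (Real.sqrt_nonneg t)).mp h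
      rw [(Real.sqrt_eq_zero (hnn r hr)).mp hr0.1, (Real.sqrt_eq_zero (hnn t ht)).mp hr0.2, hPCP,
        smul_zero]
    · rw [inv_mul_cancel₀ h, one_smul]

lemma DQ.fst_star (q : DQ) : fst (star q) = star (fst q) := by
  change fst (inl (star (fst q)) + inr (star (snd q))) = _
  simp

lemma DQ.snd_star (q : DQ) : snd (star q) = star (snd q) := by
  change snd (inl (star (fst q)) + inr (star (snd q))) = _
  simp

lemma DQ.snd_mul (p q : DQ) : snd (p * q) = fst p * snd q + snd p * fst q := by
  simp [TrivSqZeroExt.snd_mul]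

/-- `A = B* B` is a perfect Hermitian matrix: there is a positive semidefinite dual
quaternion Hermitian matrix `L` with `L² = A`. -/
theorem gram_matrix_is_perfect_hermitian {m n : ℕ}
    (B : Matrix (Fin m) (Fin n) DQ) :
    ∃ L : Matrix (Fin n) (Fin n) DQ,
      L.IsHermitian ∧
      (∀ x : Fin n → DQ, DQ.le 0 (∑ i, star (x i) * L.mulVec x i)) ∧
      L * L = Bᴴ * B := by
  obtain ⟨L₀, L₁, h₀, h₁, hnn, hker, hsq, hlyap⟩ :=
    exists_sqrt_gram_and_lyapunov (B.map fst) (B.map snd)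
  refine ⟨of fun i j => inl (L₀ i j) + inr (L₁ i j), ?_, fun x => ?_, ?_⟩
  · ext1 i j
    refine TrivSqZeroExt.ext ?_ ?_
    · simpa [DQ.fst_star] using congrFun (congrFun h₀ i) j
    · simpa [DQ.snd_star] using congrFun (congrFun h₁ i) j
  · have hfst : fst (∑ i, star (x i) *
        (of fun i j => (inl (L₀ i j) + inr (L₁ i j) : DQ)).mulVec x i) =
        star (fst ∘ x) ⬝ᵥ L₀ *ᵥ (fst ∘ x) := by
      simp [dotProduct, mulVec, TrivSqZeroExt.fst_sum, DQ.fst_star]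
    have hsnd : snd (∑ i, star (x i) *
        (of fun i j => (inl (L₀ i j) + inr (L₁ i j) : DQ)).mulVec x i) =
        star (fst ∘ x) ⬝ᵥ (L₀ *ᵥ (snd ∘ x) + L₁ *ᵥ (fst ∘ x)) +
          star (snd ∘ x) ⬝ᵥ L₀ *ᵥ (fst ∘ x) := by
      simp [dotProduct, mulVec, TrivSqZeroExt.fst_sum, TrivSqZeroExt.snd_sum, DQ.fst_star,
        DQ.snd_star, Finset.sum_add_distrib]
    rw [DQ.le, hfst, hsnd]
    rcases (hnn (fst ∘ x)).lt_or_eq with h | h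
    · exact Or.inl h
    · obtain ⟨hL, hL₁⟩ := hker _ h.symm
      refine Or.inr ⟨h, ?_⟩
      rw [dotProduct_add, ← h₀, ← star_mulVec_dotProduct, h₀, hL, hL₁]
      simp
  · ext1 i j
    refine TrivSqZeroExt.ext ?_ ?_
    · simpa [mul_apply, TrivSqZeroExt.fst_sum, DQ.fst_star] using congrFun (congrFun hsq i) j
    · simpa [mul_apply, TrivSqZeroExt.snd_sum, DQ.fst_star, DQ.snd_star, DQ.snd_mul,
        Finset.sum_add_distrib] using congrFun (congrFun hlyap i) j
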